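/- arXiv:1604.02911 — 7 statements merged into one kernel-verified Lean document; each statement's English description precedes it below -/
import Mathlib

section
/- Let H be a group, a a central element of H of infinite order, and p, q nonzero integers. Let G = ⟨H, t ∣ t⁻¹ aᵖ t = a^q⟩ be the HNN extension of H with associated subgroups ⟨aᵖ⟩ and ⟨a^q⟩ and isomorphism a^{pk} ↦ a^{qk}, with stable letter t. Identifying H with its image in G, one has H ∩ t H t⁻¹ = ⟨aᵖ⟩; in particular, H ∩ t H t⁻¹ is contained in the center of H. -/
namespace HNNExtension

/-- In an HNN extension, the base group meets its conjugate by the stable letter exactly in the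
target associated subgroup. -/
theorem range_of_inf_map_conj_t {G : Type*} [Group G] {A B : Subgroup G} (φ : A ≃* B) :
    (of : G →* HNNExtension G A B φ).range ⊓
      Subgroup.map (MulAut.conj (t : HNNExtension G A B φ)).toMonoidHom
        (of : G →* HNNExtension G A B φ).range =
      Subgroup.map (of : G →* HNNExtension G A B φ) B := by
  ext x
  constructor
  · rintro ⟨hx, _, ⟨h, rfl⟩, rfl⟩
    by_cases hA : h ∈ A
    · exact ⟨φ ⟨h, hA⟩, (φ ⟨h, hA⟩).2, by simp [equiv_eq_conj]⟩
    · let w : NormalWord.ReducedWord G A B :=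
        { head := 1
          toList := [(1, h), (-1, 1)]
          chain := by simp [hA] }
      have hw : w.toList = [] := ReducedWord.toList_eq_nil_of_mem_of_range φ w <| by
        simpa [w, NormalWord.ReducedWord.prod, mul_assoc] using hx
      simp [w] at hw
  · rintro ⟨b, hb, rfl⟩
    refine ⟨⟨b, rfl⟩, of (φ.symm ⟨b, hb⟩ : G), ⟨_, rfl⟩, ?_⟩
    simp [← equiv_eq_conj]

end HNNExtension


/-- Let `H` be a group, `a` a central element of infinite order, and
`p, q` nonzero integers. In the HNN extension `G = ⟨H, t ∣ t⁻¹ aᵖ t = a^q⟩`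
(realized as the Mathlib HNN extension with associated subgroups `⟨a^q⟩` and `⟨aᵖ⟩`
and isomorphism `φ : a^{qk} ↦ a^{pk}`, so that the defining relation
`t a^{qk} t⁻¹ = a^{pk}` is exactly `t⁻¹ a^{pk} t = a^{qk}`), identifying `H` with its
image under `of : H →* G`, one has `H ⊓ t H t⁻¹ = ⟨aᵖ⟩`; in particular
`H ⊓ t H t⁻¹` is contained in (the image of) the center of `H`. -/
theorem stmt2 (H : Type*) [Group H] (a : H)
    (ha_central : a ∈ Subgroup.center H) (ha_inf : ¬ IsOfFinOrder a)
    (p q : ℤ) (hp : p ≠ 0) (hq : q ≠ 0)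
    (φ : (Subgroup.zpowers (a ^ q) : Subgroup H) ≃* (Subgroup.zpowers (a ^ p) : Subgroup H))
    (hφ : ∀ k : ℤ,
      (φ ⟨(a ^ q) ^ k, Subgroup.zpow_mem _ (Subgroup.mem_zpowers _) k⟩ : H) = (a ^ p) ^ k) :
    ((HNNExtension.of :
        H →* HNNExtension H (Subgroup.zpowers (a ^ q)) (Subgroup.zpowers (a ^ p)) φ).range ⊓
      Subgroup.map (MulAut.conj (HNNExtension.t :
          HNNExtension H (Subgroup.zpowers (a ^ q)) (Subgroup.zpowers (a ^ p)) φ)).toMonoidHom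
        (HNNExtension.of :
          H →* HNNExtension H (Subgroup.zpowers (a ^ q)) (Subgroup.zpowers (a ^ p)) φ).range) =
      Subgroup.map (HNNExtension.of :
          H →* HNNExtension H (Subgroup.zpowers (a ^ q)) (Subgroup.zpowers (a ^ p)) φ)
        (Subgroup.zpowers (a ^ p)) ∧
    ((HNNExtension.of :
        H →* HNNExtension H (Subgroup.zpowers (a ^ q)) (Subgroup.zpowers (a ^ p)) φ).range ⊓
      Subgroup.map (MulAut.conj (HNNExtension.t :
          HNNExtension H (Subgroup.zpowers (a ^ q)) (Subgroup.zpowers (a ^ p)) φ)).toMonoidHom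
        (HNNExtension.of :
          H →* HNNExtension H (Subgroup.zpowers (a ^ q)) (Subgroup.zpowers (a ^ p)) φ).range) ≤
      Subgroup.map (HNNExtension.of :
          H →* HNNExtension H (Subgroup.zpowers (a ^ q)) (Subgroup.zpowers (a ^ p)) φ)
        (Subgroup.center H) := by
  have h := HNNExtension.range_of_inf_map_conj_t φ
  refine ⟨h, h.trans_le (Subgroup.map_mono ?_)⟩
  rw [Subgroup.zpowers_le]
  exact Subgroup.zpow_mem _ ha_central p
end

section
/- Let (X, μ) be a standard Borel probability space and let T : X → X be a measurable bijection with measurable inverse that preserves μ and satisfies μ({x ∈ X ∣ T x = x}) = 0. Then there exist measurable sets P₁, P₂, P₃ ⊆ X that are pairwise disjoint with μ(P₁ ∪ P₂ ∪ P₃) = 1, such that μ(P_i ∩ T⁻¹(P_i)) = 0 for each i = 1, 2, 3. Moreover one may take P₂ = T(P₁) and P₃ = X \ (P₁ ∪ P₂). -/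
open MeasureTheory
open Set

/-- The greedy union of a sequence of sets `A`: the points of `A n` are adjoined at stage `n + 1`
unless one of their neighbours along the orbit of `T` has already been chosen. -/
def greedyOrbitUnion {X : Type*} (T : X ≃ X) (A : ℕ → Set X) : ℕ → Set X
  | 0 => ∅
  | n + 1 => greedyOrbitUnion T A n ∪
      (A n \ (T ⁻¹' greedyOrbitUnion T A n ∪ T.symm ⁻¹' greedyOrbitUnion T A n))

theorem monotone_greedyOrbitUnion {X : Type*} (T : X ≃ X) (A : ℕ → Set X) :
    Monotone (greedyOrbitUnion T A) :=
  monotone_nat_of_le_succ fun _ => subset_union_left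

theorem disjoint_preimage_greedyOrbitUnion {X : Type*} (T : X ≃ X) {A : ℕ → Set X}
    (hA : ∀ n, Disjoint (A n) (T ⁻¹' A n)) (n : ℕ) :
    Disjoint (greedyOrbitUnion T A n) (T ⁻¹' greedyOrbitUnion T A n) := by
  induction n with
  | zero => simp [greedyOrbitUnion]
  | succ n ih =>
    rw [Set.disjoint_left] at ih ⊢
    have h := Set.disjoint_left.1 (hA n)
    rintro x (hx | ⟨hx, hx'⟩) (hy | ⟨hy, hy'⟩)
    · exact ih hx hy
    · exact hy' (Or.inr (by simpa using hx))
    · exact hx' (Or.inl hy)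
    · exact h hx hy

theorem measurableSet_greedyOrbitUnion {X : Type*} [MeasurableSpace X] (T : X ≃ᵐ X)
    {A : ℕ → Set X} (hA : ∀ n, MeasurableSet (A n)) (n : ℕ) :
    MeasurableSet (greedyOrbitUnion T.toEquiv A n) := by
  induction n with
  | zero => exact MeasurableSet.empty
  | succ n ih =>
    exact ih.union ((hA n).diff ((T.measurable ih).union (T.symm.measurable ih)))

/-- Given countably many measurable sets, each disjoint from its preimage, there is a measurable
set `B` disjoint from its preimage such that every point of their union lies in `B` or has a
neighbour along its orbit in `B`. -/
theorem MeasurableEquiv.exists_maximal_disjoint_preimage {X : Type*} [MeasurableSpace X]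
    (T : X ≃ᵐ X) {A : ℕ → Set X} (hAm : ∀ n, MeasurableSet (A n))
    (hA : ∀ n, Disjoint (A n) (T ⁻¹' A n)) :
    ∃ B : Set X, MeasurableSet B ∧ Disjoint B (T ⁻¹' B) ∧
      ∀ n, ∀ x ∈ A n, x ∈ B ∨ T x ∈ B ∨ T.symm x ∈ B := by
  refine ⟨⋃ n, greedyOrbitUnion T.toEquiv A n,
    .iUnion (measurableSet_greedyOrbitUnion T hAm), ?_, ?_⟩
  · rw [Set.disjoint_left]
    intro x hx hy
    obtain ⟨m, hm⟩ := mem_iUnion.1 hx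
    obtain ⟨n, hn⟩ := mem_iUnion.1 hy
    exact Set.disjoint_left.1 (disjoint_preimage_greedyOrbitUnion T.toEquiv hA (max m n))
      (monotone_greedyOrbitUnion _ _ (le_max_left m n) hm)
      (monotone_greedyOrbitUnion _ _ (le_max_right m n) hn)
  · intro n x hx
    by_cases h : x ∈ T ⁻¹' greedyOrbitUnion T.toEquiv A n ∪
        T.symm ⁻¹' greedyOrbitUnion T.toEquiv A n
    · exact Or.inr (h.imp (mem_iUnion_of_mem n) (mem_iUnion_of_mem n))
    · exact Or.inl (mem_iUnion_of_mem (n + 1) (Or.inr ⟨hx, h⟩))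

/-- The points moved by `T` are covered by countably many measurable sets, each disjoint from its
preimage. -/
theorem Measurable.exists_seq_disjoint_preimage {X : Type*} [MeasurableSpace X]
    [MeasurableSpace.CountablySeparated X] {T : X → X} (hT : Measurable T) :
    ∃ A : ℕ → Set X, (∀ n, MeasurableSet (A n)) ∧ (∀ n, Disjoint (A n) (T ⁻¹' A n)) ∧
      ∀ x, T x ≠ x → ∃ n, x ∈ A n := by
  obtain ⟨S, hSm, hS⟩ := exists_seq_separating X (p := MeasurableSet) MeasurableSet.empty univ
  have hdisj (U : Set X) : Disjoint (U \ T ⁻¹' U) (T ⁻¹' (U \ T ⁻¹' U)) :=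
    disjoint_sdiff_left.mono_right (preimage_mono sdiff_subset)
  let V : ℕ ⊕ ℕ → Set X := Sum.elim S fun n => (S n)ᶜ
  have hV (i : ℕ ⊕ ℕ) : MeasurableSet (V i) := by
    cases i with
    | inl n => exact hSm n
    | inr n => exact (hSm n).compl
  obtain ⟨e, he⟩ := exists_surjective_nat (ℕ ⊕ ℕ)
  refine ⟨fun n => V (e n) \ T ⁻¹' V (e n), fun n => (hV _).diff (hT (hV _)),
    fun n => hdisj _, fun x hx => ?_⟩
  have hex : ∃ i, x ∈ V i ∧ T x ∉ V i := by
    by_contra! h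
    refine hx (hS (T x) trivial x trivial fun n => ⟨fun hn => ?_, h (.inl n)⟩)
    by_contra hn'
    exact h (.inr n) hn' hn
  obtain ⟨i, hi⟩ := hex
  obtain ⟨n, rfl⟩ := he i
  exact ⟨n, hi⟩

/-- If `T` is a measure preserving measurable automorphism of a standard
Borel probability space `(X, μ)` whose fixed point set is `μ`-null, then there are
pairwise disjoint measurable sets `P₁, P₂, P₃` covering `X` up to measure zero with
`μ(Pᵢ ∩ T⁻¹(Pᵢ)) = 0` for each `i`; moreover one may take `P₂ = T(P₁)` and
`P₃ = X \ (P₁ ∪ P₂)`. -/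
theorem stmt4 (X : Type*) [MeasurableSpace X] [StandardBorelSpace X]
    (μ : Measure X) [IsProbabilityMeasure μ]
    (T : X ≃ᵐ X) (hT : MeasurePreserving T μ μ)
    (hfree : μ {x : X | T x = x} = 0) :
    ∃ P₁ P₂ P₃ : Set X,
      MeasurableSet P₁ ∧ MeasurableSet P₂ ∧ MeasurableSet P₃ ∧
      Disjoint P₁ P₂ ∧ Disjoint P₁ P₃ ∧ Disjoint P₂ P₃ ∧
      μ (P₁ ∪ P₂ ∪ P₃) = 1 ∧
      μ (P₁ ∩ T ⁻¹' P₁) = 0 ∧ μ (P₂ ∩ T ⁻¹' P₂) = 0 ∧ μ (P₃ ∩ T ⁻¹' P₃) = 0 ∧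
      P₂ = T '' P₁ ∧ P₃ = (P₁ ∪ P₂)ᶜ := by
  obtain ⟨A, hAm, hA, hcover⟩ := T.measurable.exists_seq_disjoint_preimage
  obtain ⟨B, hBm, hB, hmax⟩ := T.exists_maximal_disjoint_preimage hAm hA
  rw [Set.disjoint_left] at hB
  have hTB : MeasurableSet (T '' B) := T.measurableSet_image.2 hBm
  have hdisj : Disjoint B (T '' B) := by
    rw [Set.disjoint_left]
    rintro _ hx ⟨y, hy, rfl⟩
    exact hB hy hx
  refine ⟨B, T '' B, (B ∪ T '' B)ᶜ, hBm, hTB, (hBm.union hTB).compl, hdisj,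
    disjoint_compl_right.mono_left subset_union_left,
    disjoint_compl_right.mono_left subset_union_right, ?_, ?_, ?_, ?_, rfl, rfl⟩
  · rw [union_compl_self, measure_univ]
  · rw [(Set.disjoint_left.2 hB).inter_eq, measure_empty]
  · rw [T.injective.preimage_image, hdisj.symm.inter_eq, measure_empty]
  · refine measure_mono_null (fun x hx => ?_) hfree
    by_contra hne
    obtain ⟨n, hn⟩ := hcover x hne
    rcases hmax n x hn with h | h | h
    · exact hx.1 (Or.inl h)
    · exact hx.2 (Or.inl h)
    · exact hx.1 (Or.inr ⟨_, h, T.apply_symm_apply x⟩)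
end

section
/- Let G be a countable group that is not inner amenable. Let (ξ_n) be a sequence of functions ξ_n : G → ℝ with ξ_n(g) ≥ 0 for all g ∈ G and Σ_{g ∈ G} ξ_n(g)² = 1 for all n, such that: (i) for every g ∈ G, lim_{n→∞} Σ_{h ∈ G} (ξ_n(g h g⁻¹) − ξ_n(h))² = 0; and (ii) for every h ∈ G with h ≠ e, lim_{n→∞} ξ_n(h) = 0. Then lim_{n→∞} ξ_n(e) = 1. -/
open Filter
open scoped ENNReal

/-- A mean on a countable group `G` is a positive linear functional `m` on the space
`ℓ^∞(G)` of bounded real-valued functions on `G` with `m(1) = 1`. The group `G` is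
*inner amenable* if there is a conjugation invariant mean `m` on `G` such that
`m(1_F) = 0` for every finite subset `F ⊆ G`. -/
def InnerAmenable (G : Type*) [Group G] : Prop :=
  ∃ m : lp (fun _ : G => ℝ) ∞ →ₗ[ℝ] ℝ,
    (∀ f : lp (fun _ : G => ℝ) ∞, (∀ h : G, 0 ≤ f h) → 0 ≤ m f) ∧
    (∀ f : lp (fun _ : G => ℝ) ∞, (∀ h : G, f h = 1) → m f = 1) ∧
    (∀ g : G, ∀ f f' : lp (fun _ : G => ℝ) ∞,
      (∀ h : G, f' h = f (g * h * g⁻¹)) → m f' = m f) ∧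
    (∀ F : Finset G, ∀ f : lp (fun _ : G => ℝ) ∞,
      (∀ h : G, f h = (↑F : Set G).indicator (fun _ => (1:ℝ)) h) → m f = 0)

theorem Ultrafilter.exists_tendsto_of_abs_le {ι : Type*} (U : Ultrafilter ι) (u : ι → ℝ) (C : ℝ)
    (hu : ∀ i, |u i| ≤ C) : ∃ L, Tendsto u U (nhds L) := by
  obtain ⟨L, -, hL⟩ := (isCompact_Icc (a := -C) (b := C)).ultrafilter_le_nhds' (U.map u)
    (Filter.mem_map.2 (Filter.Eventually.of_forall fun i => abs_le.mp (hu i)))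
  exact ⟨L, hL⟩

theorem tsum_abs_sq_sub_sq_le {α : Type*} {a b : α → ℝ}
    (ha : Summable fun x => a x ^ 2) (hb : Summable fun x => b x ^ 2) {t : ℝ} (ht : 0 < t) :
    ∑' x, |a x ^ 2 - b x ^ 2| ≤
      (∑' x, (a x - b x) ^ 2) / t + t * (∑' x, a x ^ 2 + ∑' x, b x ^ 2) := by
  have hd : Summable fun x => (a x - b x) ^ 2 :=
    Summable.of_nonneg_of_le (fun x => sq_nonneg _)
      (fun x => by nlinarith [sq_nonneg (a x + b x)]) ((ha.add hb).mul_left 2)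
  have hs : Summable fun x => |a x ^ 2 - b x ^ 2| := (ha.sub hb).abs
  rw [← ha.tsum_add hb, ← tsum_mul_left, ← tsum_div_const,
    ← (hd.div_const t).tsum_add ((ha.add hb).mul_left t)]
  refine hs.tsum_le_tsum (fun x => ?_) ((hd.div_const t).add ((ha.add hb).mul_left t))
  rw [← sub_nonneg]
  have key : ∀ p q : ℝ, 0 ≤ (p - q) ^ 2 / t + t * (p ^ 2 + q ^ 2) - (p ^ 2 - q ^ 2) := by
    intro p q
    have e : (p - q) ^ 2 / t + t * (p ^ 2 + q ^ 2) - (p ^ 2 - q ^ 2) =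
        ((p - q - t * (p + q) / 2) ^ 2 + t ^ 2 * ((p - q) ^ 2 / 2 + (p + q) ^ 2 / 4)) / t := by
      field_simp
      ring
    rw [e]
    positivity
  rcases abs_cases (a x ^ 2 - b x ^ 2) with ⟨h, -⟩ | ⟨h, -⟩
  · rw [h]; exact key _ _
  · rw [h]; have := key (b x) (a x)
    rw [sub_sq_comm (b x), add_comm (b x ^ 2)] at this
    linarith

/-- Asymptotically conjugation invariant nonnegative weights of mass at most one which vanish
pointwise in the limit but whose total mass does not, yield inner amenability. -/
theorem InnerAmenable.of_weights {G : Type*} [Group G] {ι : Type*} (U : Ultrafilter ι)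
    (w : ι → G → ℝ) (hw : ∀ n h, 0 ≤ w n h) (hs : ∀ n, Summable (w n))
    (hle : ∀ n, ∑' h, w n h ≤ 1) {δ : ℝ} (hδ : 0 < δ) (hmass : ∀ᶠ n in U, δ ≤ ∑' h, w n h)
    (hzero : ∀ h, Tendsto (fun n => w n h) U (nhds 0))
    (hinv : ∀ g : G, Tendsto (fun n => ∑' h, |w n (g * h * g⁻¹) - w n h|) U (nhds 0)) :
    InnerAmenable G := by
  have hb : ∀ (f : lp (fun _ : G => ℝ) ∞) (h : G), |f h| ≤ ‖f‖ := fun f h =>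
    lp.norm_apply_le_norm (by simp) f h
  have hfs : ∀ (f : lp (fun _ : G => ℝ) ∞) (v : G → ℝ), Summable v →
      Summable fun h => f h * v h := by
    intro f v hv
    refine Summable.of_norm_bounded (hv.abs.mul_left ‖f‖) fun h => ?_
    rw [Real.norm_eq_abs, abs_mul]
    exact mul_le_mul_of_nonneg_right (hb f h) (abs_nonneg _)
  have hfb : ∀ (f : lp (fun _ : G => ℝ) ∞) (v : G → ℝ), Summable v →
      |∑' h, f h * v h| ≤ ‖f‖ * ∑' h, |v h| := by
    intro f v hv
    rw [← tsum_mul_left, ← Real.norm_eq_abs]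
    refine tsum_of_norm_bounded (hv.abs.mul_left ‖f‖).hasSum fun h => ?_
    rw [Real.norm_eq_abs, abs_mul]
    exact mul_le_mul_of_nonneg_right (hb f h) (abs_nonneg _)
  have hex : ∀ f : lp (fun _ : G => ℝ) ∞,
      ∃ L, Tendsto (fun n => ∑' h, f h * w n h) U (nhds L) := by
    intro f
    refine U.exists_tendsto_of_abs_le _ ‖f‖ fun n => (hfb f _ (hs n)).trans ?_
    simp only [abs_of_nonneg (hw n _)]
    exact mul_le_of_le_one_right (norm_nonneg f) (hle n)
  obtain ⟨c, hc⟩ : ∃ c, Tendsto (fun n => ∑' h, w n h) U (nhds c) :=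
    U.exists_tendsto_of_abs_le _ 1 fun n => by
      rw [abs_of_nonneg (tsum_nonneg (hw n))]; exact hle n
  have hcpos : 0 < c := hδ.trans_le (ge_of_tendsto hc hmass)
  choose L hL using hex
  let m : lp (fun _ : G => ℝ) ∞ →ₗ[ℝ] ℝ :=
    { toFun := fun f => c⁻¹ * L f
      map_add' := fun f f' => by
        have : L (f + f') = L f + L f' := by
          refine tendsto_nhds_unique (hL _) (((hL f).add (hL f')).congr fun n => ?_)
          rw [← (hfs f _ (hs n)).tsum_add (hfs f' _ (hs n))]
          simp [add_mul]
        rw [this, mul_add]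
      map_smul' := fun r f => by
        have : L (r • f) = r * L f := by
          refine tendsto_nhds_unique (hL _) (((hL f).const_mul r).congr fun n => ?_)
          rw [← tsum_mul_left]
          simp [mul_assoc]
        simp only [this, smul_eq_mul, RingHom.id_apply]
        ring }
  have hm : ∀ f, m f = c⁻¹ * L f := fun _ => rfl
  refine ⟨m, fun f hf => ?_, fun f hf => ?_, fun g f f' hff => ?_, fun F f hf => ?_⟩
  · rw [hm]
    exact mul_nonneg (inv_nonneg.2 hcpos.le)
      (ge_of_tendsto' (hL f) fun n => tsum_nonneg fun h => mul_nonneg (hf h) (hw n h))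
  · have : L f = c := tendsto_nhds_unique (hL f) (hc.congr fun n => by simp [hf])
    rw [hm, this, inv_mul_cancel₀ hcpos.ne']
  · have hsub : ∀ n, ∑' h, f' h * w n h - ∑' h, f h * w n h =
        ∑' h, f h * (w n (g⁻¹ * h * g⁻¹⁻¹) - w n h) := by
      intro n
      have hconj : Summable fun h => w n (g⁻¹ * h * g⁻¹⁻¹) :=
        (hs n).comp_injective (MulAut.conj g⁻¹).injective
      have : ∑' h, f' h * w n h = ∑' h, f h * w n (g⁻¹ * h * g⁻¹⁻¹) := by
        rw [← (MulAut.conj g).toEquiv.tsum_eq fun h => f h * w n (g⁻¹ * h * g⁻¹⁻¹)]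
        refine tsum_congr fun h => ?_
        simp [hff, mul_assoc]
      rw [this, ← (hfs f _ hconj).tsum_sub (hfs f _ (hs n))]
      simp only [mul_sub]
    have hdiff : Tendsto (fun n => ∑' h, f' h * w n h - ∑' h, f h * w n h) U (nhds 0) := by
      refine squeeze_zero_norm (fun n => ?_) (by simpa only [mul_zero] using (hinv g⁻¹).const_mul ‖f‖)
      rw [hsub, Real.norm_eq_abs]
      exact hfb f (fun h => w n (g⁻¹ * h * g⁻¹⁻¹) - w n h)
        (((hs n).comp_injective (MulAut.conj g⁻¹).injective).sub (hs n))
    have := tendsto_nhds_unique hdiff ((hL f').sub (hL f))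
    rw [hm, hm, sub_eq_zero.1 this.symm]
  · have : L f = 0 := by
      refine tendsto_nhds_unique (hL f) ?_
      have hsum : Tendsto (fun n => ∑ h ∈ F, w n h) U (nhds 0) := by
        simpa using tendsto_finsetSum F fun h _ => hzero h
      refine hsum.congr fun n => ?_
      rw [tsum_eq_sum (s := F) fun h hh => by simp [hf, hh]]
      exact Finset.sum_congr rfl fun h hh => by simp [hf, hh]
    rw [hm, this, mul_zero]

/-- If `G` is a countable group that is not inner amenable and `(ξₙ)` is a
sequence of unit vectors in `ℓ²(G)` with nonnegative entries that is asymptotically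
conjugation invariant and tends to `0` pointwise away from the identity, then
`ξₙ(e) → 1`. -/
theorem stmt6 (G : Type*) [Group G] [Countable G]
    (hG : ¬ InnerAmenable G)
    (ξ : ℕ → G → ℝ)
    (hpos : ∀ n, ∀ g : G, 0 ≤ ξ n g)
    (hnorm : ∀ n, ∑' g : G, (ξ n g) ^ 2 = 1)
    (hinv : ∀ g : G,
      Tendsto (fun n => ∑' h : G, (ξ n (g * h * g⁻¹) - ξ n h) ^ 2) atTop (nhds 0))
    (hvanish : ∀ h : G, h ≠ 1 → Tendsto (fun n => ξ n h) atTop (nhds 0)) :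
    Tendsto (fun n => ξ n 1) atTop (nhds 1) := by
  have hs : ∀ n, Summable fun h => ξ n h ^ 2 := fun n => by
    by_contra h
    simpa [tsum_eq_zero_of_not_summable h] using hnorm n
  have hone : ∀ n, ξ n 1 ≤ 1 := fun n => by
    have := (hs n).le_tsum 1 fun _ _ => sq_nonneg _
    rw [hnorm] at this
    nlinarith [hpos n 1]
  by_contra hnot
  apply hG
  obtain ⟨ε, hε, hfreq⟩ : ∃ ε > 0, ∃ᶠ n in atTop, ξ n 1 ≤ 1 - ε := by
    by_contra! hcon
    refine hnot (tendsto_order.2 ⟨fun a ha => ?_, fun a ha =>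
      Eventually.of_forall fun n => (hone n).trans_lt ha⟩)
    have := hcon (1 - a) (by linarith)
    filter_upwards [this] with n hn
    linarith
  have : NeBot (atTop ⊓ Filter.principal {n | ξ n 1 ≤ 1 - ε}) := frequently_mem_iff_neBot.1 hfreq
  obtain ⟨U, hU⟩ := Ultrafilter.exists_le (atTop ⊓ Filter.principal {n | ξ n 1 ≤ 1 - ε})
  have hUtop : (U : Filter ℕ) ≤ atTop := hU.trans inf_le_left
  have hUε : ∀ᶠ n in U, ξ n 1 ≤ 1 - ε := le_principal_iff.1 (hU.trans inf_le_right)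
  classical
  obtain ⟨η, hη1, hηne⟩ : ∃ η : ℕ → G → ℝ,
      (∀ n, η n 1 = 0) ∧ ∀ n h, h ≠ 1 → η n h = ξ n h :=
    ⟨fun n => Function.update (ξ n) 1 0, fun n => by simp, fun n h hh => by simp [hh]⟩
  have hη : ∀ n, HasSum (fun h => η n h ^ 2) (1 - ξ n 1 ^ 2) := fun n => by
    have h := (hs n).hasSum.update 1 0
    rw [hnorm] at h
    have e : (fun h => η n h ^ 2) = Function.update (fun h => ξ n h ^ 2) 1 0 := by
      ext x
      by_cases hx : x = 1
      · simp [hx, hη1]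
      · simp [hx, hηne]
    rw [e, show 1 - ξ n 1 ^ 2 = 0 - ξ n 1 ^ 2 + 1 by ring]
    exact h
  have hηconj : ∀ n g, HasSum (fun h => η n (g * h * g⁻¹) ^ 2) (1 - ξ n 1 ^ 2) := fun n g =>
    (MulAut.conj g).toEquiv.hasSum_iff.2 (hη n)
  have hηinv : ∀ g : G,
      Tendsto (fun n => ∑' h : G, (η n (g * h * g⁻¹) - η n h) ^ 2) atTop (nhds 0) := by
    refine fun g => (hinv g).congr fun n => tsum_congr fun h => ?_
    by_cases hh : h = 1
    · simp [hh, hη1]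
    · rw [hηne n h hh, hηne n _ (by simpa using hh)]
  refine InnerAmenable.of_weights U (fun n h => η n h ^ 2) (fun n h => sq_nonneg _)
    (fun n => (hη n).summable) (fun n => ?_) hε ?_ (fun h => ?_) (fun g => ?_)
  · rw [(hη n).tsum_eq]
    linarith [sq_nonneg (ξ n 1)]
  · filter_upwards [hUε] with n hn
    rw [(hη n).tsum_eq]
    nlinarith [hpos n 1, hone n]
  · by_cases hh : h = 1
    · simp [hh, hη1]
    · simpa [hηne _ h hh] using ((hvanish h hh).mono_left hUtop).pow 2
  · refine Tendsto.mono_left ?_ hUtop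
    refine tendsto_order.2 ⟨fun a ha => Eventually.of_forall fun n =>
      ha.trans_le (tsum_nonneg fun _ => abs_nonneg _), fun a ha => ?_⟩
    have ht : 0 < a / 4 := by positivity
    filter_upwards [(hηinv g).eventually_lt_const (pow_pos ht 2)] with n hn
    have hle := (tsum_abs_sq_sub_sq_le (hηconj n g).summable (hη n).summable ht)
    rw [(hηconj n g).tsum_eq, (hη n).tsum_eq] at hle
    have h1 : (∑' h, (η n (g * h * g⁻¹) - η n h) ^ 2) / (a / 4) < a / 4 := by
      rw [div_lt_iff₀ ht, ← sq]
      exact hn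
    have h2 : a / 4 * (1 - ξ n 1 ^ 2 + (1 - ξ n 1 ^ 2)) ≤ a / 4 * 2 :=
      mul_le_mul_of_nonneg_left (by linarith [sq_nonneg (ξ n 1)]) ht.le
    linarith
end

section
/- Let A be a group and C ≤ A a subgroup. Let G = A *_C (C × ℤ) be the amalgamated free product of A and C × ℤ over C, where C is embedded in A by the inclusion and in C × ℤ as C × {0}, and let t ∈ G denote the image of the generator (e, 1) of the ℤ factor. Identify A with its image in G. Then for every h ∈ A with h ∉ C, the map ℤ → G, k ↦ t^k h t^{−k}, is injective; that is, the elements t^k h t^{−k}, k ∈ ℤ, are pairwise distinct. -/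
universe u

/-- The family of the two factors of the amalgamated free product `A *_C (C × ℤ)`:
the factor indexed by `true` is `A` and the factor indexed by `false` is `C × ℤ`
(with `ℤ` written multiplicatively). -/
def AmalgFam (A C : Type u) : Bool → Type u
  | true => A
  | false => C × Multiplicative ℤ

instance (A C : Type u) [Group A] [Group C] : (b : Bool) → Group (AmalgFam A C b)
  | true => inferInstanceAs (Group A)
  | false => inferInstanceAs (Group (C × Multiplicative ℤ))

/-- The embeddings of `C` into the two factors: `C` embeds into `A` by the inclusion
and into `C × ℤ` as `C × {0}`. -/
def amalgHom {A : Type u} [Group A] (C : Subgroup A) :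
    (b : Bool) → (↥C →* AmalgFam A ↥C b)
  | true => C.subtype
  | false => MonoidHom.inl ↥C (Multiplicative ℤ)

/-- The amalgamated free product `G = A *_C (C × ℤ)`, realized as the pushout of the
two embeddings of `C`. -/
abbrev AmalgProd {A : Type u} [Group A] (C : Subgroup A) : Type u :=
  Monoid.PushoutI (amalgHom C)

/-- The image `t ∈ G` of the generator `(e, 1)` of the `ℤ` factor of `C × ℤ`. -/
def amalgT {A : Type u} [Group A] (C : Subgroup A) : AmalgProd C :=
  Monoid.PushoutI.of (φ := amalgHom C) false ((1 : ↥C), Multiplicative.ofAdd 1)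

/-- An alternating product of four letters outside the base group is nontrivial. -/
theorem Monoid.PushoutI.of_mul_of_mul_of_mul_of_ne_one {ι H : Type*} {G : ι → Type*}
    [∀ i, Group (G i)] [Group H] {φ : ∀ i, H →* G i} (hφ : ∀ i, Function.Injective (φ i))
    {i j : ι} (hij : i ≠ j) {x y : G i} {a b : G j} (hx : x ∉ (φ i).range)
    (ha : a ∉ (φ j).range) (hy : y ∉ (φ i).range) (hb : b ∉ (φ j).range) :
    of (φ := φ) i x * of j a * of i y * of j b ≠ 1 := by
  intro heq
  have hletters : ∀ g ∈ ([⟨i, x⟩, ⟨j, a⟩, ⟨i, y⟩, ⟨j, b⟩] : List (Σ i, G i)),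
      g.2 ∉ (φ g.1).range := by
    simp only [List.forall_mem_cons]
    exact ⟨hx, ha, hy, hb, by simp⟩
  let w : CoprodI.Word G :=
    { toList := [⟨i, x⟩, ⟨j, a⟩, ⟨i, y⟩, ⟨j, b⟩]
      ne_one := fun g hg hg1 => hletters g hg (hg1 ▸ one_mem _)
      chain_ne := by simp [hij, hij.symm] }
  have hw : Reduced φ w := hletters
  have hprod : ofCoprodI (φ := φ) w.prod = 1 := by
    rw [← heq]
    simp [w, CoprodI.Word.prod, mul_assoc]
  have hempty := hw.eq_empty_of_mem_range hφ (hprod ▸ one_mem _)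
  exact List.cons_ne_nil _ _ (congrArg CoprodI.Word.toList hempty)

theorem amalgT_zpow {A : Type u} [Group A] (C : Subgroup A) (n : ℤ) :
    amalgT C ^ n =
      Monoid.PushoutI.of (φ := amalgHom C) false ((1 : ↥C), Multiplicative.ofAdd n) := by
  refine (map_zpow (Monoid.PushoutI.of (φ := amalgHom C) false) _ n).symm.trans
    (congrArg (Monoid.PushoutI.of (φ := amalgHom C) false) ?_)
  change ((1 : ↥C), Multiplicative.ofAdd (1 : ℤ)) ^ n = ((1 : ↥C), Multiplicative.ofAdd n)
  simp [← ofAdd_zsmul]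

theorem amalgHom_injective {A : Type u} [Group A] (C : Subgroup A) (b : Bool) :
    Function.Injective (amalgHom C b) := by
  cases b
  · exact fun _ _ h => congrArg (fun p : ↥C × Multiplicative ℤ => p.1) h
  · exact C.subtype_injective

theorem ofAdd_notMem_range_amalgHom {A : Type u} [Group A] (C : Subgroup A) {n : ℤ}
    (hn : n ≠ 0) :
    (((1 : ↥C), Multiplicative.ofAdd n) : AmalgFam A ↥C false) ∉ (amalgHom C false).range := by
  rintro ⟨c, hc⟩
  exact hn (congrArg (fun p : ↥C × Multiplicative ℤ => p.2.toAdd) hc).symm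

theorem notMem_range_amalgHom {A : Type u} [Group A] (C : Subgroup A) {h : A} (hh : h ∉ C) :
    (h : AmalgFam A ↥C true) ∉ (amalgHom C true).range := by
  rintro ⟨c, rfl⟩
  exact hh c.2

/-- A nontrivial power of `t` commutes with no element of `A` outside `C`. -/
theorem amalgT_zpow_conj_ne {A : Type u} [Group A] (C : Subgroup A) {h : A} (hh : h ∉ C)
    {n : ℤ} (hn : n ≠ 0) :
    amalgT C ^ n * Monoid.PushoutI.of (φ := amalgHom C) true h * amalgT C ^ (-n) *
      Monoid.PushoutI.of (φ := amalgHom C) true (h⁻¹ : A) ≠ 1 := by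
  rw [amalgT_zpow, amalgT_zpow]
  exact Monoid.PushoutI.of_mul_of_mul_of_mul_of_ne_one (amalgHom_injective C)
    Bool.false_ne_true (ofAdd_notMem_range_amalgHom C hn) (notMem_range_amalgHom C hh)
    (ofAdd_notMem_range_amalgHom C (neg_ne_zero.mpr hn))
    (notMem_range_amalgHom C (mt C.inv_mem_iff.mp hh))

/-- In `G = A *_C (C × ℤ)`, for every `h ∈ A` with `h ∉ C`, the elements
`t^k h t^{-k}`, `k ∈ ℤ`, are pairwise distinct. -/
theorem stmt7 {A : Type u} [Group A] (C : Subgroup A) (h : A) (hh : h ∉ C) :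
    Function.Injective (fun k : ℤ =>
      amalgT C ^ k * Monoid.PushoutI.of (φ := amalgHom C) true h * amalgT C ^ (-k)) := by
  intro k l hkl
  by_contra hne
  apply amalgT_zpow_conj_ne C hh (sub_ne_zero.mpr hne)
  have hinv : Monoid.PushoutI.of (φ := amalgHom C) true (h⁻¹ : A) =
      (Monoid.PushoutI.of (φ := amalgHom C) true h)⁻¹ :=
    map_inv (Monoid.PushoutI.of (φ := amalgHom C) true) h
  rw [hinv, mul_inv_eq_one]
  have hconj := congrArg (fun x => amalgT C ^ (-l) * x * amalgT C ^ l) hkl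
  calc _ = amalgT C ^ (-l) * (amalgT C ^ k * Monoid.PushoutI.of (φ := amalgHom C) true h *
        amalgT C ^ (-k)) * amalgT C ^ l := by
        rw [neg_sub, sub_eq_neg_add, sub_eq_neg_add, zpow_add, zpow_add]
        simp only [mul_assoc]
    _ = _ := hconj
    _ = _ := by simp [mul_assoc]
end

section
/- Let A be a group, C a normal subgroup of A, and H a subgroup of A with C ≤ H ≤ A such that C has infinite index in H. Let G = A *_C (C × ℤ) be the amalgamated free product of A and C × ℤ over C, where C is embedded in A by the inclusion and in C × ℤ as C × {0}. Identify A and H with their images in G. Then for every g ∈ G with g ∉ A, the set {h g h⁻¹ ∣ h ∈ H} is infinite. -/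
universe u

theorem FreeGroup.toWord_map_of_injective {α β : Type*} [DecidableEq α] [DecidableEq β]
    {f : α → β} (hf : Function.Injective f) (x : FreeGroup α) :
    (FreeGroup.map f x).toWord = x.toWord.map fun p => (f p.1, p.2) := by
  have h : FreeGroup.IsReduced (x.toWord.map fun p => (f p.1, p.2)) :=
    (List.isChain_map _).2
      ((FreeGroup.isReduced_toWord (x := x)).imp fun _ _ hab h => hab (hf h))
  conv_lhs => rw [← FreeGroup.mk_toWord (x := x), FreeGroup.map.mk, FreeGroup.toWord_mk]
  exact h.reduce_eq

theorem FreeGroup.eq_one_of_map_mul_left_eq {Q : Type*} [Group Q] {q : Q} {x : FreeGroup Q}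
    (hx : x ≠ 1) (h : FreeGroup.map (q * ·) x = x) : q = 1 := by
  classical
  have hw := congrArg FreeGroup.toWord h
  rw [FreeGroup.toWord_map_of_injective (mul_right_injective q)] at hw
  cases hl : x.toWord with
  | nil => exact absurd (FreeGroup.toWord_eq_nil_iff.1 hl) hx
  | cons p l =>
    simp only [hl, List.map_cons, List.cons.injEq, Prod.ext_iff, mul_eq_right] at hw
    exact hw.1.1

/-- The action of a group on the free group on its elements, by left translation of the
generators. -/
def translationAut (Q : Type*) [Group Q] : Q →* MulAut (FreeGroup Q) where
  toFun q := FreeGroup.freeGroupCongr (Equiv.mulLeft q)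
  map_one' := by
    ext x
    simp [FreeGroup.freeGroupCongr]
  map_mul' p q := by
    refine MulEquiv.ext fun x => ?_
    simp [FreeGroup.freeGroupCongr, FreeGroup.map.comp, Function.comp_def]

theorem translationAut_apply {Q : Type*} [Group Q] (q : Q) (x : FreeGroup Q) :
    translationAut Q q x = FreeGroup.map (q * ·) x := rfl

section AmalgProd

open Monoid SemidirectProduct

variable {A : Type u} [Group A] (C : Subgroup A)

/-- The embedding of `A` into `A *_C (C × ℤ)`. -/
def amalgIncl : A →* AmalgProd C := PushoutI.of (φ := amalgHom C) true

/-- The embedding of `C × ℤ` into `A *_C (C × ℤ)`. -/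
def amalgInclProd : C × Multiplicative ℤ →* AmalgProd C :=
  PushoutI.of (φ := amalgHom C) false

theorem amalgIncl_coe (c : C) : amalgIncl C c = PushoutI.base (amalgHom C) c :=
  PushoutI.of_apply_eq_base (amalgHom C) true c

theorem amalgInclProd_left (c : C) : amalgInclProd C (c, 1) = amalgIncl C c :=
  (PushoutI.of_apply_eq_base (amalgHom C) false c).trans (amalgIncl_coe C c).symm

theorem amalgInclProd_right (n : ℤ) :
    amalgInclProd C (1, Multiplicative.ofAdd n) = amalgT C ^ n := by
  change _ = amalgInclProd C (1, Multiplicative.ofAdd 1) ^ n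
  rw [← map_zpow, Prod.pow_mk, one_zpow, ← ofAdd_zsmul, smul_eq_mul, mul_one]

theorem amalgInclProd_apply (c : C) (n : Multiplicative ℤ) :
    amalgInclProd C (c, n) = amalgT C ^ n.toAdd * amalgIncl C c := by
  rw [← amalgInclProd_left, ← amalgInclProd_right, ← map_mul]
  simp

theorem commute_amalgT_amalgIncl (c : C) : Commute (amalgT C) (amalgIncl C c) := by
  rw [← amalgInclProd_left]
  change Commute (amalgInclProd C (1, Multiplicative.ofAdd 1)) _
  exact Commute.map (by simp [commute_iff_eq]) _

/-- The homomorphism from the free group on `A ⧸ C` sending the generator `aC` to `a t a⁻¹`. -/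
noncomputable def conjAmalgT : FreeGroup (A ⧸ C) →* AmalgProd C :=
  FreeGroup.lift fun q => amalgIncl C q.out * amalgT C * (amalgIncl C q.out)⁻¹

theorem conjAmalgT_of_mk (a : A) :
    conjAmalgT C (FreeGroup.of (a : A ⧸ C)) =
      amalgIncl C a * amalgT C * (amalgIncl C a)⁻¹ := by
  obtain ⟨c, hc⟩ := QuotientGroup.mk_out_eq_mul C a
  rw [conjAmalgT, FreeGroup.lift_apply_of, hc, map_mul, mul_assoc (amalgIncl C a),
    ← (commute_amalgT_amalgIncl C c).eq]
  group

variable [C.Normal]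

theorem conjAmalgT_translationAut (a : A) (x : FreeGroup (A ⧸ C)) :
    conjAmalgT C (translationAut (A ⧸ C) a x) =
      amalgIncl C a * conjAmalgT C x * (amalgIncl C a)⁻¹ := by
  suffices (conjAmalgT C).comp (translationAut (A ⧸ C) a).toMonoidHom =
      (MulAut.conj (amalgIncl C a)).toMonoidHom.comp (conjAmalgT C) from
    DFunLike.congr_fun this x
  refine FreeGroup.ext_hom _ _ fun q => ?_
  induction q using QuotientGroup.induction_on with
  | H b =>
    simp [translationAut_apply, ← QuotientGroup.mk_mul, conjAmalgT_of_mk, mul_assoc]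

/-- The projection of `A *_C (C × ℤ)` onto its quotient by `C`, which is the free product of
`A ⧸ C` and `ℤ`, realized as the semidirect product of `A ⧸ C` with the free group on its
elements. -/
def amalgProj : AmalgProd C →* FreeGroup (A ⧸ C) ⋊[translationAut (A ⧸ C)] (A ⧸ C) :=
  PushoutI.lift
    (fun
      | true => inr.comp (QuotientGroup.mk' C)
      | false => inl.comp ((zpowersHom _ (FreeGroup.of 1)).comp (MonoidHom.snd C _)))
    1 (by
      rintro (_ | _)
      · refine MonoidHom.ext fun c => ?_
        change inl (zpowersHom _ (FreeGroup.of 1) 1) = _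
        simp
      · refine MonoidHom.ext fun c => ?_
        have : ((c : A) : A ⧸ C) = 1 := (QuotientGroup.eq_one_iff _).2 c.2
        change inr ((c : A) : A ⧸ C) = _
        simp [this])

theorem amalgProj_amalgIncl (a : A) : amalgProj C (amalgIncl C a) = inr (a : A ⧸ C) :=
  PushoutI.lift_of _ _ _ _

theorem amalgProj_amalgT : amalgProj C (amalgT C) = inl (FreeGroup.of 1) :=
  (PushoutI.lift_of _ _ _ _).trans (by
    change inl (zpowersHom _ (FreeGroup.of 1) (Multiplicative.ofAdd 1)) = _
    simp)

theorem exists_eq_conjAmalgT_mul (g : AmalgProd C) :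
    ∃ a : A, g = conjAmalgT C (amalgProj C g).left * amalgIncl C a ∧
      (amalgProj C g).right = a := by
  have incl (a : A) : ∃ b : A, amalgIncl C a =
      conjAmalgT C (amalgProj C (amalgIncl C a)).left * amalgIncl C b ∧
      (amalgProj C (amalgIncl C a)).right = b :=
    ⟨a, by simp [amalgProj_amalgIncl]⟩
  have mul (x y : AmalgProd C)
      (hx : ∃ a : A, x = conjAmalgT C (amalgProj C x).left * amalgIncl C a ∧
        (amalgProj C x).right = a)
      (hy : ∃ a : A, y = conjAmalgT C (amalgProj C y).left * amalgIncl C a ∧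
        (amalgProj C y).right = a) :
      ∃ a : A, x * y = conjAmalgT C (amalgProj C (x * y)).left * amalgIncl C a ∧
        (amalgProj C (x * y)).right = a := by
    obtain ⟨a, hx, ha⟩ := hx
    obtain ⟨b, hy, hb⟩ := hy
    refine ⟨a * b, ?_, by simp [ha, hb]⟩
    rw [map_mul, mul_left, ha, map_mul, conjAmalgT_translationAut, map_mul]
    conv_lhs => rw [hx, hy]
    group
  induction g using PushoutI.induction_on with
  | of i x =>
    match i, x with
    | true, a => exact incl a
    | false, (c, n) =>
      change ∃ a : A, amalgInclProd C (c, n) =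
        conjAmalgT C (amalgProj C (amalgInclProd C (c, n))).left * amalgIncl C a ∧
        (amalgProj C (amalgInclProd C (c, n))).right = a
      rw [amalgInclProd_apply]
      refine mul _ _ ⟨1, ?_⟩ (incl c)
      have h1 := conjAmalgT_of_mk C 1
      rw [QuotientGroup.mk_one, map_one, one_mul, inv_one, mul_one] at h1
      rw [map_zpow, amalgProj_amalgT, ← map_zpow, left_inl, right_inl, map_zpow, h1]
      simp
  | base c =>
    rw [← amalgIncl_coe]
    exact incl c
  | mul x y hx hy => exact mul x y hx hy

/-- Conjugation by `a ∈ A` can fix an element outside `A` only if `a ∈ C`. -/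
theorem mem_of_commute_amalgIncl {g : AmalgProd C} (hg : g ∉ (amalgIncl C).range) {a : A}
    (h : Commute (amalgIncl C a) g) : a ∈ C := by
  have hne : (amalgProj C g).left ≠ 1 := fun h1 => by
    obtain ⟨b, hb, -⟩ := exists_eq_conjAmalgT_mul C g
    exact hg ⟨b, by rw [hb, h1, map_one, one_mul]⟩
  have hl := congrArg SemidirectProduct.left (h.map (amalgProj C)).eq
  simp only [amalgProj_amalgIncl, mul_left, left_inr, right_inr, one_mul, map_one, mul_one,
    translationAut_apply] at hl
  exact (QuotientGroup.eq_one_iff a).1 (FreeGroup.eq_one_of_map_mul_left_eq hne hl)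

end AmalgProd

/-- Let `C` be a normal subgroup of `A` and `H` a subgroup with
`C ≤ H ≤ A` such that `C` has infinite index in `H`. In `G = A *_C (C × ℤ)`,
identifying `A` and `H` with their images, for every `g ∈ G` with `g ∉ A` the set
`{h g h⁻¹ ∣ h ∈ H}` is infinite. -/
theorem stmt8 {A : Type u} [Group A] (C H : Subgroup A) [C.Normal]
    (hCH : C ≤ H) (hindex : Infinite (↥H ⧸ C.subgroupOf H))
    (g : AmalgProd C)
    (hg : g ∉ (Monoid.PushoutI.of (φ := amalgHom C) true : A →* AmalgProd C).range) :
    {x : AmalgProd C | ∃ h ∈ H,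
      Monoid.PushoutI.of (φ := amalgHom C) true h * g *
        (Monoid.PushoutI.of (φ := amalgHom C) true h)⁻¹ = x}.Infinite := by
  refine Set.infinite_of_injective_forall_mem
    (f := fun q : H ⧸ C.subgroupOf H =>
      amalgIncl C (q.out : A) * g * (amalgIncl C (q.out : A))⁻¹)
    (fun p q hpq => ?_) fun q => ⟨q.out, q.out.2, rfl⟩
  rw [← QuotientGroup.out_eq' p, ← QuotientGroup.out_eq' q, QuotientGroup.eq,
    Subgroup.mem_subgroupOf]
  refine mem_of_commute_amalgIncl C hg ?_
  simp only [Subgroup.coe_mul, Subgroup.coe_inv, map_mul, map_inv]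
  set x := amalgIncl C (p.out : A)
  set y := amalgIncl C (q.out : A)
  calc x⁻¹ * y * g = x⁻¹ * (y * g * y⁻¹) * y := by group
    _ = x⁻¹ * (x * g * x⁻¹) * y := congrArg (x⁻¹ * · * y) hpq.symm
    _ = g * (x⁻¹ * y) := by group
end

section
/- Let A be a group, C ≤ A a subgroup, and K a normal subgroup of A with K ≤ C. Let G = A *_C (C × ℤ) be the amalgamated free product of A and C × ℤ over C, where C is embedded in A by the inclusion and in C × ℤ as C × {0}. Then the image of K in G is a normal subgroup of G. -/
universe u

universe v w x

theorem Monoid.PushoutI.normal_map_base {ι : Type v} {G : ι → Type w} {H : Type x}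
    [∀ i, Group (G i)] [Group H] (φ : ∀ i, H →* G i) (N : Subgroup H) [N.Normal]
    (hN : ∀ i, (N.map (φ i)).Normal) : (N.map (Monoid.PushoutI.base φ)).Normal := by
  refine ⟨fun n hn g => ?_⟩
  induction g using Monoid.PushoutI.induction_on generalizing n with
  | of i g =>
    obtain ⟨k, hk, rfl⟩ := hn
    obtain ⟨k', hk', h⟩ := (hN i).conj_mem _ (Subgroup.mem_map_of_mem (φ i) hk) g
    refine ⟨k', hk', ?_⟩
    rw [← Monoid.PushoutI.of_apply_eq_base φ i, h, map_mul, map_mul, map_inv,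
      Monoid.PushoutI.of_apply_eq_base]
  | base h =>
    obtain ⟨k, hk, rfl⟩ := hn
    exact ⟨h * k * h⁻¹, Subgroup.Normal.conj_mem ‹_› k hk h, by simp only [map_mul, map_inv]⟩
  | mul a b ha hb =>
    simpa only [mul_inv_rev, mul_assoc] using ha _ (hb n hn)

/-- Let `C ≤ A` be a subgroup and `K` a normal subgroup of `A` with
`K ≤ C`. Then the image of `K` in `G = A *_C (C × ℤ)` is a normal subgroup of `G`. -/
theorem stmt9 {A : Type u} [Group A] (C K : Subgroup A) [K.Normal] (hKC : K ≤ C) :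
    (K.map (Monoid.PushoutI.of (φ := amalgHom C) true : A →* AmalgProd C)).Normal := by
  have hK : (K.subgroupOf C).map C.subtype = K := Subgroup.map_subgroupOf_eq_of_le hKC
  have key : ((K.subgroupOf C).map (Monoid.PushoutI.base (amalgHom C))).Normal := by
    refine Monoid.PushoutI.normal_map_base _ _ fun i => ?_
    cases i with
    | true =>
      change ((K.subgroupOf C).map C.subtype).Normal
      rwa [hK]
    | false =>
      change ((K.subgroupOf C).map (MonoidHom.inl C (Multiplicative ℤ))).Normal
      refine ⟨?_⟩
      rintro _ ⟨k, hk, rfl⟩ ⟨c, z⟩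
      exact ⟨c * k * c⁻¹, Subgroup.Normal.conj_mem inferInstance k hk c, by simp⟩
  rw [← Monoid.PushoutI.of_comp_eq_base true, ← Subgroup.map_map] at key
  change (((K.subgroupOf C).map C.subtype).map
    (Monoid.PushoutI.of (φ := amalgHom C) true : A →* AmalgProd C)).Normal at key
  rwa [hK] at key
end

section
/- Let A be a group, C ≤ A a subgroup, and K a normal subgroup of A with K ≤ C. Let G = A *_C (C × ℤ) be the amalgamated free product of A and C × ℤ over C, where C is embedded in A by the inclusion and in C × ℤ as C × {0}, and let t ∈ G denote the image of the generator (e, 1) of the ℤ factor. Let π : G → A be the unique homomorphism that restricts to the identity on (the image of) A and satisfies π(t) = e, i.e. the homomorphism induced by the identity of A and the projection C × ℤ → C ≤ A. Then for every g ∈ G, the element g π(g)⁻¹ commutes with every element of (the image of) K. -/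
universe u

/-- The canonical map of the factor `A` into `A *_C (C × ℤ)`. -/
def amalgInclusion {A : Type u} [Group A] (C : Subgroup A) : A →* AmalgProd C :=
  Monoid.PushoutI.of (φ := amalgHom C) true

theorem amalgInclusion_coe {A : Type u} [Group A] (C : Subgroup A) (c : C) :
    amalgInclusion C c =
      Monoid.PushoutI.of (φ := amalgHom C) false ((c, 1) : C × Multiplicative ℤ) :=
  (Monoid.PushoutI.of_apply_eq_base (amalgHom C) true c).trans
    (Monoid.PushoutI.of_apply_eq_base (amalgHom C) false c).symm

/-- The canonical map of the factor `C × ℤ` into `A *_C (C × ℤ)`. -/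
def amalgProdInclusion {A : Type u} [Group A] (C : Subgroup A) :
    C × Multiplicative ℤ →* AmalgProd C :=
  Monoid.PushoutI.of (φ := amalgHom C) false

theorem amalgProdInclusion_apply {A : Type u} [Group A] (C : Subgroup A)
    (x : C × Multiplicative ℤ) :
    amalgProdInclusion C x = amalgInclusion C x.1 * amalgT C ^ x.2.toAdd := by
  have ht : amalgT C = amalgProdInclusion C (1, Multiplicative.ofAdd 1) := rfl
  have hc : amalgInclusion C x.1 = amalgProdInclusion C (x.1, 1) := amalgInclusion_coe C x.1
  rw [ht, hc, ← map_zpow, ← map_mul]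
  congr 1
  ext
  · simp
  · simp [← ofAdd_zsmul]

theorem commute_amalgT {A : Type u} [Group A] (C : Subgroup A) {c : A} (hc : c ∈ C) :
    Commute (amalgT C) (amalgInclusion C c) := by
  have ht : amalgT C = amalgProdInclusion C (1, Multiplicative.ofAdd 1) := rfl
  have hc' : amalgInclusion C c = amalgProdInclusion C (⟨c, hc⟩, 1) :=
    amalgInclusion_coe C ⟨c, hc⟩
  rw [ht, hc']
  refine Commute.map ?_ (amalgProdInclusion C)
  simp [Commute, SemiconjBy]

/-- Conjugation by `g` acts on the image of a normal subgroup `K ≤ C` of `A` as conjugation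
by `π g`. -/
theorem semiconjBy_amalgInclusion {A : Type u} [Group A] (C K : Subgroup A) [K.Normal]
    (hKC : K ≤ C) (π : AmalgProd C →* A) (hπA : ∀ a : A, π (amalgInclusion C a) = a)
    (hπt : π (amalgT C) = 1) (g : AmalgProd C) {k : A} (hk : k ∈ K) :
    SemiconjBy g (amalgInclusion C k) (amalgInclusion C (π g * k * (π g)⁻¹)) := by
  have hA (a k : A) : SemiconjBy (amalgInclusion C a) (amalgInclusion C k)
      (amalgInclusion C (π (amalgInclusion C a) * k * (π (amalgInclusion C a))⁻¹)) := by
    rw [hπA]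
    exact (SemiconjBy.conj_mk a k).map (amalgInclusion C)
  have hB (x : C × Multiplicative ℤ) {k : A} (hk : k ∈ K) :
      SemiconjBy (amalgProdInclusion C x) (amalgInclusion C k)
        (amalgInclusion C (π (amalgProdInclusion C x) * k * (π (amalgProdInclusion C x))⁻¹)) := by
    have hπx : π (amalgProdInclusion C x) = π (amalgInclusion C x.1) := by
      rw [amalgProdInclusion_apply, map_mul, map_zpow, hπt, one_zpow, mul_one]
    rw [hπx, amalgProdInclusion_apply]
    exact (hA _ k).mul_left ((commute_amalgT C (hKC hk)).zpow_left _)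
  induction g using Monoid.PushoutI.induction_on generalizing k with
  | of i x =>
    cases i with
    | true => exact hA x k
    | false => exact hB x hk
  | base c =>
    rw [← Monoid.PushoutI.of_apply_eq_base (amalgHom C) true c]
    exact hA c k
  | mul x y hx hy =>
    have hyk := ‹K.Normal›.conj_mem k hk (π y)
    simpa [mul_assoc] using (hx hyk).mul_left (hy hk)

/-- Let `C ≤ A` be a subgroup and `K` a normal subgroup of `A` with
`K ≤ C`. Let `π : G → A` be the unique homomorphism on `G = A *_C (C × ℤ)` that
restricts to the identity on `A` and satisfies `π(t) = e` (the homomorphism induced by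
the identity of `A` and the projection `C × ℤ → C ≤ A`). Then for every `g ∈ G`, the
element `g π(g)⁻¹` commutes with every element of the image of `K` in `G`. -/
theorem stmt10 {A : Type u} [Group A] (C K : Subgroup A) [K.Normal] (hKC : K ≤ C)
    (π : AmalgProd C →* A)
    (hπA : ∀ a : A, π (Monoid.PushoutI.of (φ := amalgHom C) true a) = a)
    (hπt : π (amalgT C) = 1)
    (g : AmalgProd C) (k : A) (hk : k ∈ K) :
    Commute (g * (Monoid.PushoutI.of (φ := amalgHom C) true (π g))⁻¹)
      (Monoid.PushoutI.of (φ := amalgHom C) true k) := by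
  have h := semiconjBy_amalgInclusion C K hKC π hπA hπt g
    (by simpa using ‹K.Normal›.conj_mem k hk (π g)⁻¹ : (π g)⁻¹ * k * π g ∈ K)
  have h' : SemiconjBy (amalgInclusion C (π g))⁻¹ (amalgInclusion C k)
      (amalgInclusion C ((π g)⁻¹ * k * π g)) := by
    rw [← map_inv]
    simpa using (SemiconjBy.conj_mk (π g)⁻¹ k).map (amalgInclusion C)
  have hgk : π g * ((π g)⁻¹ * k * π g) * (π g)⁻¹ = k := by group
  rw [hgk] at h
  exact h.mul_left h'
end
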